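/- arXiv:1510.05532 — 2 statements merged into one kernel-verified Lean document; each statement's English description precedes it below -/
import Mathlib

section
/- A GLMB density integrates to one: the set integral of π(X) = Δ(X) ∑_{c∈ℂ} w^(c)(L(X)) [p^(c)]^X over all finite subsets of 𝕏×𝕃 equals ∑_{L⊆𝕃} ∑_{c∈ℂ} w^(c)(L) = 1. Equivalently, ∑_{n=0}^∞ (1/n!) ∑_{ℓ₁,…,ℓₙ ∈ 𝕃} ∫_{𝕏ⁿ} π({(x₁,ℓ₁),…,(xₙ,ℓₙ)}) d(x₁,…,xₙ) = 1. -/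
open MeasureTheory ENNReal

/-- Injective enumerations of a finite set `J` by `Fin n` are the bijections `Fin n ≃ J`. -/
noncomputable def injectiveImageEquiv {L : Type*} [DecidableEq L] (n : ℕ) (J : Finset L) :
    {f : Fin n → L // Function.Injective f ∧ Finset.image f Finset.univ = J} ≃ (Fin n ≃ J) where
  toFun f := Equiv.ofBijective
    (fun i => ⟨f.1 i, f.2.2.subset (Finset.mem_image_of_mem _ (Finset.mem_univ i))⟩)
    ⟨fun i j h => f.2.1 (congrArg Subtype.val h), fun y => by
      obtain ⟨i, -, hi⟩ := Finset.mem_image.1 (f.2.2.superset y.2)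
      exact ⟨i, Subtype.ext hi⟩⟩
  invFun e := ⟨fun i => e i, Subtype.val_injective.comp e.injective, by
    ext a
    simp only [Finset.mem_image, Finset.mem_univ, true_and]
    exact ⟨fun ⟨i, hi⟩ => hi ▸ (e i).2, fun ha => ⟨e.symm ⟨a, ha⟩, by simp⟩⟩⟩
  left_inv f := rfl
  right_inv e := by ext; rfl

theorem enatCard_injective_image {L : Type*} [DecidableEq L] (n : ℕ) (J : Finset L) :
    ENat.card {f : Fin n → L // Function.Injective f ∧ Finset.image f Finset.univ = J} =
      if J.card = n then (n.factorial : ℕ∞) else 0 := by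
  rw [ENat.card_congr (injectiveImageEquiv n J)]
  split_ifs with h
  · have e : Fin n ≃ J := (finCongr h.symm).trans J.equivFin.symm
    rw [ENat.card_eq_coe_fintype_card, Fintype.card_equiv e, Fintype.card_fin]
  · have : IsEmpty (Fin n ≃ J) := ⟨fun e => h (by simpa using (Fintype.card_congr e).symm)⟩
    simp

/-- Summing a function of the image over injective tuples counts each `n`-element set `n!` times. -/
theorem tsum_injective_image {L : Type*} [DecidableEq L] (n : ℕ) (F : Finset L → ℝ≥0∞) :
    ∑' f : Fin n → L, (if Function.Injective f then F (Finset.image f Finset.univ) else 0) =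
      n.factorial * ∑' J : Finset L, if J.card = n then F J else 0 := by
  calc
    _ = ∑' f : Fin n → L, ∑' J : Finset L,
          if Function.Injective f ∧ Finset.image f Finset.univ = J then F J else 0 := by
      refine tsum_congr fun f => ?_
      by_cases hf : Function.Injective f
      · rw [tsum_eq_single (Finset.image f Finset.univ) fun J hJ => if_neg fun h => hJ h.2.symm]
        simp [hf]
      · simp [hf]
    _ = ∑' J : Finset L, ∑' f : Fin n → L,
          if Function.Injective f ∧ Finset.image f Finset.univ = J then F J else 0 :=
      ENNReal.tsum_comm
    _ = ∑' J : Finset L, n.factorial * if J.card = n then F J else 0 := by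
      refine tsum_congr fun J => ?_
      have h := tsum_subtype
        {f : Fin n → L | Function.Injective f ∧ Finset.image f Finset.univ = J} fun _ => F J
      simp only [Set.indicator_apply, Set.mem_ofPred_eq] at h
      rw [← h, ENNReal.tsum_const]
      change ((ENat.card {f : Fin n → L //
        Function.Injective f ∧ Finset.image f Finset.univ = J} : ℕ∞) : ℝ≥0∞) * F J = _
      rw [enatCard_injective_image]
      split_ifs <;> simp
    _ = _ := ENNReal.tsum_mul_left

/-- Tonelli's theorem for a product of functions of the separate coordinates. -/
theorem lintegral_fin_prod_eq_prod {n : ℕ} {X : Type*} [MeasurableSpace X] (μ : Measure X)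
    [SigmaFinite μ] (f : Fin n → X → ℝ≥0∞) (hf : ∀ i, Measurable (f i)) :
    ∫⁻ xs : Fin n → X, ∏ i, f i (xs i) ∂Measure.pi (fun _ => μ) = ∏ i, ∫⁻ x, f i x ∂μ := by
  induction n with
  | zero => simp
  | succ n ih =>
    have tail_meas : Measurable fun xs : Fin n → X => ∏ i, f i.succ (xs i) :=
      Finset.measurable_prod _ fun i _ => (hf i.succ).comp (measurable_pi_apply i)
    rw [Fin.prod_univ_succ, ← ih (fun i => f i.succ) fun i => hf i.succ,
      ← lintegral_prod_mul (hf 0).aemeasurable tail_meas.aemeasurable]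
    refine Eq.trans (lintegral_congr fun xs => ?_)
      ((measurePreserving_piFinSuccAbove (fun _ : Fin (n + 1) => μ) 0).lintegral_comp
        (((hf 0).comp measurable_fst).mul (tail_meas.comp measurable_snd)))
    rw [Fin.prod_univ_succ]
    rfl

/-- A finite product of probability densities has integral one. -/
theorem lintegral_ofReal_prod_density {n : ℕ} {X : Type*} [MeasureSpace X]
    [SigmaFinite (volume : Measure X)] (q : Fin n → X → ℝ) (hq0 : ∀ i x, 0 ≤ q i x)
    (hqm : ∀ i, Measurable (q i)) (hq1 : ∀ i, ∫⁻ x, ENNReal.ofReal (q i x) = 1) :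
    ∫⁻ xs : Fin n → X, ENNReal.ofReal (∏ i, q i (xs i)) = 1 := by
  simp_rw [ENNReal.ofReal_prod_of_nonneg fun i _ => hq0 i _]
  rw [volume_pi, lintegral_fin_prod_eq_prod volume (fun i x => ENNReal.ofReal (q i x))
    fun i => (hqm i).ennreal_ofReal]
  simp [hq1]

/-- a GLMB density integrates to one.  The GLMB density
`π(X) = Δ(X) ∑_{c} w⁽ᶜ⁾(L(X)) [p⁽ᶜ⁾]^X` on finite subsets of `𝕏 × 𝕃`
(represented by tuples of labeled points) has set integral
`∑_{L⊆𝕃} ∑_{c} w⁽ᶜ⁾(L) = 1`. -/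
theorem glmb_integrates_to_one
    {d : ℕ} {L ι : Type*} [Countable L] [DecidableEq L] [Fintype ι]
    (w : ι → Finset L → ℝ) (hw : ∀ c J, 0 ≤ w c J)
    (p : ι → (Fin d → ℝ) → L → ℝ)
    (hp0 : ∀ c x ℓ, 0 ≤ p c x ℓ)
    (hpm : ∀ c ℓ, Measurable fun x => p c x ℓ)
    (hp1 : ∀ c ℓ, ∫⁻ x, ENNReal.ofReal (p c x ℓ) = 1)
    (hwsum : ∑' J : Finset L, ∑ c, ENNReal.ofReal (w c J) = 1) :
    ∑' n : ℕ, (Nat.factorial n : ℝ≥0∞)⁻¹ *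
      ∑' ℓs : Fin n → L,
        ∫⁻ xs : Fin n → (Fin d → ℝ),
          ENNReal.ofReal ((if Function.Injective ℓs then (1:ℝ) else 0) *
            ∑ c, w c (Finset.image ℓs Finset.univ) * ∏ i, p c (xs i) (ℓs i))
    = 1 := by
  have integral_eq : ∀ (n : ℕ) (ℓs : Fin n → L),
      ∫⁻ xs : Fin n → (Fin d → ℝ),
          ENNReal.ofReal ((if Function.Injective ℓs then (1:ℝ) else 0) *
            ∑ c, w c (Finset.image ℓs Finset.univ) * ∏ i, p c (xs i) (ℓs i)) =
        if Function.Injective ℓs then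
          ∑ c, ENNReal.ofReal (w c (Finset.image ℓs Finset.univ)) else 0 := by
    intro n ℓs
    split_ifs with h
    · have prod_nonneg : ∀ c (xs : Fin n → (Fin d → ℝ)), 0 ≤ ∏ i, p c (xs i) (ℓs i) :=
        fun c xs => Finset.prod_nonneg fun i _ => hp0 c _ _
      have prod_meas : ∀ c, Measurable fun xs : Fin n → (Fin d → ℝ) =>
          ENNReal.ofReal (∏ i, p c (xs i) (ℓs i)) := fun c =>
        (Finset.measurable_prod _ fun i _ =>
          (hpm c (ℓs i)).comp (measurable_pi_apply i)).ennreal_ofReal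
      simp_rw [one_mul,
        ENNReal.ofReal_sum_of_nonneg fun c _ => mul_nonneg (hw c _) (prod_nonneg c _),
        ENNReal.ofReal_mul (hw _ _)]
      rw [lintegral_finsetSum _ fun c _ => (prod_meas c).const_mul _]
      refine Finset.sum_congr rfl fun c _ => ?_
      rw [lintegral_const_mul _ (prod_meas c),
        lintegral_ofReal_prod_density (fun i x => p c x (ℓs i)) (fun i x => hp0 c x _)
          (fun i => hpm c _) (fun i => hp1 c _), mul_one]
    · simp
  calc
    _ = ∑' n : ℕ, ∑' J : Finset L,
          if J.card = n then ∑ c, ENNReal.ofReal (w c J) else 0 := by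
      refine tsum_congr fun n => ?_
      simp_rw [integral_eq]
      rw [tsum_injective_image n fun J => ∑ c, ENNReal.ofReal (w c J), ← mul_assoc,
        ENNReal.inv_mul_cancel (by exact_mod_cast n.factorial_ne_zero)
          (ENNReal.natCast_ne_top _), one_mul]
    _ = ∑' J : Finset L, ∑ c, ENNReal.ofReal (w c J) := by
      rw [ENNReal.tsum_comm]
      refine tsum_congr fun J => ?_
      rw [tsum_eq_single J.card fun n hn => if_neg hn.symm, if_pos rfl]
    _ = 1 := hwsum
end

section
/- (Proposition 3, scalar case: GLMBs with Gaussian-mixture single-object densities.) Let 𝕏 = ℝ and K = 1, and let φ and ψ be GLMB densities whose single-object densities are Gaussian mixtures: p_φ^(c)(x,ℓ) = ∑_{i=1}^{N_φ^(c)} ω_{φ,i}^(c)(ℓ) N(x; m_{φ,i}^(c)(ℓ), P_{φ,i}^(c)(ℓ)) and p_ψ^(d)(x,ℓ) = ∑_{j=1}^{N_ψ^(d)} ω_{ψ,j}^(d)(ℓ) N(x; m_{ψ,j}^(d)(ℓ), P_{ψ,j}^(d)(ℓ)), where N(x; m, P) is the Gaussian density with mean m and variance P > 0, the mixture weights are nonnegative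 and sum to one. Then ⟨φ,ψ⟩_K = ∑_{L⊆𝕃} ∑_{c∈ℂ} ∑_{d∈𝔻} w_φ^(c)(L) w_ψ^(d)(L) ∏_{ℓ∈L} γ_{φ,ψ}(ℓ), where γ_{φ,ψ}(ℓ) = ∑_{i=1}^{N_φ^(c)} ∑_{j=1}^{N_ψ^(d)} ω_{φ,i}^(c)(ℓ) ω_{ψ,j}^(d)(ℓ) N(m_{φ,i}^(c)(ℓ); m_{ψ,j}^(d)(ℓ), P_{φ,i}^(c)(ℓ) + P_{ψ,j}^(d)(ℓ)). -/
open MeasureTheory ENNReal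

/-- The one-dimensional Gaussian probability density with mean `m` and
variance `P`: `N(x; m, P) = (2πP)^{-1/2} exp(−(x−m)²/(2P))`. -/
noncomputable def gaussN (x m P : ℝ) : ℝ :=
  (Real.sqrt (2 * Real.pi * P))⁻¹ * Real.exp (-((x - m) ^ 2) / (2 * P))

/-- The product of two Gaussian densities in `x` is a Gaussian density in `x`, up to a factor
which is the Gaussian density of the difference of the means. -/
lemma gaussN_mul_gaussN {P Q : ℝ} (hP : 0 < P) (hQ : 0 < Q) (x m m' : ℝ) :
    gaussN x m P * gaussN x m' Q =
      gaussN m m' (P + Q) * gaussN x ((m * Q + m' * P) / (P + Q)) (P * Q / (P + Q)) := by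
  have hPQ : 0 < P + Q := add_pos hP hQ
  unfold gaussN
  rw [mul_mul_mul_comm, mul_mul_mul_comm (Real.sqrt (2 * Real.pi * (P + Q)))⁻¹,
    ← mul_inv, ← mul_inv, ← Real.sqrt_mul (by positivity), ← Real.sqrt_mul (by positivity),
    ← Real.exp_add, ← Real.exp_add]
  congr 2
  · congr 1
    field_simp
  · field_simp
    ring

lemma gaussN_nonneg (x m P : ℝ) : 0 ≤ gaussN x m P := by
  unfold gaussN
  positivity

lemma measurable_gaussN (m P : ℝ) : Measurable fun x => gaussN x m P := by
  unfold gaussN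
  fun_prop

lemma lintegral_gaussN {P : ℝ} (hP : 0 < P) (m : ℝ) :
    ∫⁻ x, ENNReal.ofReal (gaussN x m P) = 1 := by
  have h := ProbabilityTheory.lintegral_gaussianPDFReal_eq_one m (v := ⟨P, hP.le⟩)
    (fun h => hP.ne' (congrArg NNReal.toReal h))
  exact h

lemma lintegral_gaussN_mul_gaussN {P Q : ℝ} (hP : 0 < P) (hQ : 0 < Q) (m m' : ℝ) :
    ∫⁻ x, ENNReal.ofReal (gaussN x m P * gaussN x m' Q) =
      ENNReal.ofReal (gaussN m m' (P + Q)) := by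
  simp_rw [gaussN_mul_gaussN hP hQ, ENNReal.ofReal_mul (gaussN_nonneg m m' (P + Q))]
  rw [lintegral_const_mul _ (measurable_gaussN _ _).ennreal_ofReal,
    lintegral_gaussN (by positivity), mul_one]

lemma lintegral_gaussian_mixture_mul {α β : Type*} [Fintype α] [Fintype β]
    (u m P : α → ℝ) (v m' Q : β → ℝ) (hu : ∀ a, 0 ≤ u a) (hv : ∀ b, 0 ≤ v b)
    (hP : ∀ a, 0 < P a) (hQ : ∀ b, 0 < Q b) :
    ∫⁻ x, ENNReal.ofReal ((∑ a, u a * gaussN x (m a) (P a)) *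
        ∑ b, v b * gaussN x (m' b) (Q b)) =
      ENNReal.ofReal (∑ a, ∑ b, u a * v b * gaussN (m a) (m' b) (P a + Q b)) := by
  have huv (a b) : 0 ≤ u a * v b := mul_nonneg (hu a) (hv b)
  have hterm (x : ℝ) : ENNReal.ofReal ((∑ a, u a * gaussN x (m a) (P a)) *
      ∑ b, v b * gaussN x (m' b) (Q b)) = ∑ a, ∑ b, ENNReal.ofReal (u a * v b) *
        ENNReal.ofReal (gaussN x (m a) (P a) * gaussN x (m' b) (Q b)) := by
    have hnn (a b) : 0 ≤ u a * v b * (gaussN x (m a) (P a) * gaussN x (m' b) (Q b)) :=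
      mul_nonneg (huv a b) (mul_nonneg (gaussN_nonneg _ _ _) (gaussN_nonneg _ _ _))
    simp_rw [Finset.sum_mul_sum, mul_mul_mul_comm (u _)]
    rw [ENNReal.ofReal_sum_of_nonneg fun a _ => Finset.sum_nonneg fun b _ => hnn a b]
    refine Finset.sum_congr rfl fun a _ => ?_
    rw [ENNReal.ofReal_sum_of_nonneg fun b _ => hnn a b]
    exact Finset.sum_congr rfl fun b _ => ENNReal.ofReal_mul (huv a b)
  have hmeas (a b) : Measurable fun x => ENNReal.ofReal
      (gaussN x (m a) (P a) * gaussN x (m' b) (Q b)) :=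
    ((measurable_gaussN _ _).mul (measurable_gaussN _ _)).ennreal_ofReal
  simp_rw [hterm]
  rw [lintegral_finsetSum _ fun a _ =>
    Finset.measurable_sum _ fun b _ => (hmeas a b).const_mul _]
  rw [ENNReal.ofReal_sum_of_nonneg fun a _ => Finset.sum_nonneg fun b _ =>
    mul_nonneg (huv a b) (gaussN_nonneg _ _ _)]
  refine Finset.sum_congr rfl fun a _ => ?_
  rw [lintegral_finsetSum _ fun b _ => (hmeas a b).const_mul _,
    ENNReal.ofReal_sum_of_nonneg fun b _ => mul_nonneg (huv a b) (gaussN_nonneg _ _ _)]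
  refine Finset.sum_congr rfl fun b _ => ?_
  rw [lintegral_const_mul _ (hmeas a b), lintegral_gaussN_mul_gaussN (hP a) (hQ b),
    ENNReal.ofReal_mul (huv a b)]

/-- Tonelli's theorem for a product of functions of one coordinate each. -/
lemma lintegral_prod_eq_prod_lintegral {E : Type*} [MeasurableSpace E] (μ : Measure E)
    [SigmaFinite μ] {n : ℕ} (f : Fin n → E → ℝ≥0∞) (hf : ∀ i, Measurable (f i)) :
    ∫⁻ x : Fin n → E, ∏ i, f i (x i) ∂Measure.pi (fun _ => μ) = ∏ i, ∫⁻ x, f i x ∂μ := by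
  induction n with
  | zero => simp
  | succ n ih =>
    have hm : Measurable fun y : Fin n → E => ∏ i : Fin n, f i.succ (y i) :=
      Finset.measurable_prod _ fun i _ => (hf i.succ).comp (measurable_pi_apply i)
    have hmp := measurePreserving_piFinSuccAbove (fun _ : Fin (n + 1) => μ) 0
    have hcomp := hmp.lintegral_comp
      (f := fun z : E × (Fin n → E) => f 0 z.1 * ∏ i : Fin n, f i.succ (z.2 i))
      (((hf 0).comp measurable_fst).mul (hm.comp measurable_snd))
    rw [Fin.prod_univ_succ, ← ih (fun i => f i.succ) fun i => hf i.succ,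
      ← lintegral_prod_mul (hf 0).aemeasurable hm.aemeasurable]
    simp_rw [Fin.prod_univ_succ]
    exact hcomp

/-- The product of two finite mixtures of product densities integrates to the mixture of the
products of the one-dimensional integrals. -/
lemma lintegral_mixture_prod_mul {ι κ : Type*} [Fintype ι] [Fintype κ] {n : ℕ}
    (u : ι → ℝ) (v : κ → ℝ) (hu : ∀ c, 0 ≤ u c) (hv : ∀ e, 0 ≤ v e)
    (f : ι → Fin n → ℝ → ℝ) (g : κ → Fin n → ℝ → ℝ)
    (hf : ∀ c i x, 0 ≤ f c i x) (hg : ∀ e i x, 0 ≤ g e i x)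
    (hfm : ∀ c i, Measurable (f c i)) (hgm : ∀ e i, Measurable (g e i)) :
    ∫⁻ xs : Fin n → ℝ, ENNReal.ofReal
        ((∑ c, u c * ∏ i, f c i (xs i)) * ∑ e, v e * ∏ i, g e i (xs i)) =
      ∑ c, ∑ e, ENNReal.ofReal (u c) * ENNReal.ofReal (v e) *
        ∏ i, ∫⁻ x, ENNReal.ofReal (f c i x * g e i x) := by
  have hterm (xs : Fin n → ℝ) : ENNReal.ofReal
      ((∑ c, u c * ∏ i, f c i (xs i)) * ∑ e, v e * ∏ i, g e i (xs i)) =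
      ∑ c, ∑ e, ENNReal.ofReal (u c) * ENNReal.ofReal (v e) *
        ∏ i, ENNReal.ofReal (f c i (xs i) * g e i (xs i)) := by
    have hprod (c e) : 0 ≤ ∏ i, f c i (xs i) * g e i (xs i) :=
      Finset.prod_nonneg fun i _ => mul_nonneg (hf c i _) (hg e i _)
    have hnn (c e) : 0 ≤ u c * v e * ∏ i, f c i (xs i) * g e i (xs i) :=
      mul_nonneg (mul_nonneg (hu c) (hv e)) (hprod c e)
    simp_rw [Finset.sum_mul_sum, mul_mul_mul_comm (u _), ← Finset.prod_mul_distrib]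
    rw [ENNReal.ofReal_sum_of_nonneg fun c _ => Finset.sum_nonneg fun e _ => hnn c e]
    refine Finset.sum_congr rfl fun c _ => ?_
    rw [ENNReal.ofReal_sum_of_nonneg fun e _ => hnn c e]
    refine Finset.sum_congr rfl fun e _ => ?_
    rw [ENNReal.ofReal_mul (mul_nonneg (hu c) (hv e)), ENNReal.ofReal_mul (hu c),
      ENNReal.ofReal_prod_of_nonneg fun i _ => mul_nonneg (hf c i _) (hg e i _)]
  have hm (c e i) : Measurable fun x => ENNReal.ofReal (f c i x * g e i x) :=
    ((hfm c i).mul (hgm e i)).ennreal_ofReal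
  have hmeas (c e) : Measurable fun xs : Fin n → ℝ =>
      ∏ i, ENNReal.ofReal (f c i (xs i) * g e i (xs i)) :=
    Finset.measurable_prod _ fun i _ => (hm c e i).comp (measurable_pi_apply i)
  simp_rw [hterm]
  rw [lintegral_finsetSum _ fun c _ =>
    Finset.measurable_sum _ fun e _ => (hmeas c e).const_mul _]
  refine Finset.sum_congr rfl fun c _ => ?_
  rw [lintegral_finsetSum _ fun e _ => (hmeas c e).const_mul _]
  refine Finset.sum_congr rfl fun e _ => ?_
  rw [lintegral_const_mul _ (hmeas c e)]
  congr 1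
  exact lintegral_prod_eq_prod_lintegral volume _ (hm c e)

/-- A finite set has `n!` injective enumerations by `Fin n` if it has `n` elements, and none
otherwise. -/
lemma encard_setOf_injective_image_eq {L : Type*} [DecidableEq L] (n : ℕ) (J : Finset L) :
    {f : Fin n → L | Function.Injective f ∧ Finset.image f Finset.univ = J}.encard =
      if n = J.card then (n.factorial : ℕ∞) else 0 := by
  split_ifs with h
  · have hrange : {f : Fin n → L | Function.Injective f ∧ Finset.image f Finset.univ = J} =
        Set.range fun (e : Fin n ≃ J) (i : Fin n) => (e i : L) := by
      ext f
      constructor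
      · rintro ⟨hf, rfl⟩
        refine ⟨Equiv.ofBijective
          (fun i => ⟨f i, Finset.mem_image_of_mem f (Finset.mem_univ i)⟩) ⟨?_, ?_⟩, rfl⟩
        · exact fun i j hij => hf (congrArg Subtype.val hij)
        · rintro ⟨y, hy⟩
          obtain ⟨i, -, rfl⟩ := Finset.mem_image.1 hy
          exact ⟨i, rfl⟩
      · rintro ⟨e, rfl⟩
        refine ⟨Subtype.val_injective.comp e.injective, ?_⟩
        ext y
        simp only [Finset.mem_image, Finset.mem_univ, true_and]
        constructor
        · rintro ⟨i, rfl⟩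
          exact (e i).2
        · exact fun hy => ⟨e.symm ⟨y, hy⟩, by simp⟩
    have hinj : Function.Injective fun (e : Fin n ≃ J) (i : Fin n) => (e i : L) :=
      fun e e' hee => Equiv.ext fun i => Subtype.ext (congrFun hee i)
    rw [hrange, ← Set.image_univ, hinj.encard_image, Set.encard_univ, ENat.card_eq_coe_fintype_card,
      Fintype.card_equiv (Fintype.equivOfCardEq (by simp [h])), Fintype.card_fin]
  · rw [Set.encard_eq_zero, Set.eq_empty_iff_forall_notMem]
    rintro f ⟨hf, rfl⟩
    exact h (by rw [Finset.card_image_of_injective _ hf, Finset.card_univ, Fintype.card_fin])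

/-- Summing a function of the label set over all injective label tuples, with weights `1 / n!`,
amounts to summing over all finite label sets. -/
lemma tsum_inv_factorial_mul_tsum_injective {L : Type*} [DecidableEq L] (F : Finset L → ℝ≥0∞) :
    ∑' n : ℕ, (Nat.factorial n : ℝ≥0∞)⁻¹ * ∑' f : Fin n → L,
      (if Function.Injective f then F (Finset.image f Finset.univ) else 0) = ∑' J, F J := by
  have hfiber (n : ℕ) : ∑' f : Fin n → L,
      (if Function.Injective f then F (Finset.image f Finset.univ) else 0) =
      ∑' J, (if n = J.card then (n.factorial : ℝ≥0∞) else 0) * F J := by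
    have hsplit (f : Fin n → L) :
        (if Function.Injective f then F (Finset.image f Finset.univ) else 0) =
        ∑' J, {f : Fin n → L | Function.Injective f ∧
          Finset.image f Finset.univ = J}.indicator (fun _ => F J) f := by
      rw [tsum_eq_single (Finset.image f Finset.univ)]
      · simp [Set.indicator_apply]
      · intro J hJ
        exact Set.indicator_of_notMem (fun h => hJ h.2.symm) _
    simp_rw [hsplit]
    rw [ENNReal.tsum_comm]
    refine tsum_congr fun J => ?_
    rw [← tsum_subtype, ENNReal.tsum_set_const, encard_setOf_injective_image_eq]
    split_ifs <;> simp
  simp_rw [hfiber, ← ENNReal.tsum_mul_left]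
  rw [ENNReal.tsum_comm]
  refine tsum_congr fun J => ?_
  rw [tsum_eq_single J.card fun n hn => by simp [hn], if_pos rfl, ← mul_assoc,
    ENNReal.inv_mul_cancel (by exact_mod_cast Nat.factorial_ne_zero _)
      (ENNReal.natCast_ne_top _), one_mul]

/-- Proposition 3, scalar case: for GLMBs on `ℝ × 𝕃` whose
single-object densities are Gaussian mixtures, and `K = 1`, the inner product
`⟨φ,ψ⟩_K` has the closed form
`∑_{L⊆𝕃} ∑_{c∈ℂ} ∑_{d∈𝔻} w_φ⁽ᶜ⁾(L) w_ψ⁽ᵈ⁾(L) ∏_{ℓ∈L} γ_{φ,ψ}(ℓ)` with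
`γ_{φ,ψ}(ℓ) = ∑_i ∑_j ω_{φ,i}⁽ᶜ⁾(ℓ) ω_{ψ,j}⁽ᵈ⁾(ℓ)
  N(m_{φ,i}⁽ᶜ⁾(ℓ); m_{ψ,j}⁽ᵈ⁾(ℓ), P_{φ,i}⁽ᶜ⁾(ℓ) + P_{ψ,j}⁽ᵈ⁾(ℓ))`. -/
theorem glmb_gaussian_mixture_innerK
    {L ι κ : Type*} [Countable L] [DecidableEq L] [Fintype ι] [Fintype κ]
    (wφ : ι → Finset L → ℝ) (hwφ : ∀ c J, 0 ≤ wφ c J)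
    (wψ : κ → Finset L → ℝ) (hwψ : ∀ e J, 0 ≤ wψ e J)
    (hwφsum : ∑' J : Finset L, ∑ c, ENNReal.ofReal (wφ c J) = 1)
    (hwψsum : ∑' J : Finset L, ∑ e, ENNReal.ofReal (wψ e J) = 1)
    (Nφ : ι → ℕ) (Nψ : κ → ℕ)
    (ωφ : (c : ι) → Fin (Nφ c) → L → ℝ) (mφ : (c : ι) → Fin (Nφ c) → L → ℝ)
    (Pφ : (c : ι) → Fin (Nφ c) → L → ℝ)
    (ωψ : (e : κ) → Fin (Nψ e) → L → ℝ) (mψ : (e : κ) → Fin (Nψ e) → L → ℝ)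
    (Pψ : (e : κ) → Fin (Nψ e) → L → ℝ)
    (hωφ0 : ∀ c i ℓ, 0 ≤ ωφ c i ℓ) (hωψ0 : ∀ e j ℓ, 0 ≤ ωψ e j ℓ)
    (hωφ1 : ∀ c ℓ, ∑ i, ωφ c i ℓ = 1) (hωψ1 : ∀ e ℓ, ∑ j, ωψ e j ℓ = 1)
    (hPφ : ∀ c i ℓ, 0 < Pφ c i ℓ) (hPψ : ∀ e j ℓ, 0 < Pψ e j ℓ) :
    ∑' n : ℕ, (Nat.factorial n : ℝ≥0∞)⁻¹ *
      ∑' ℓs : Fin n → L,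
        ∫⁻ xs : Fin n → ℝ,
          ENNReal.ofReal ((1:ℝ) ^ n *
            (((if Function.Injective ℓs then (1:ℝ) else 0) *
                ∑ c, wφ c (Finset.image ℓs Finset.univ) *
                  ∏ i, ∑ a, ωφ c a (ℓs i) * gaussN (xs i) (mφ c a (ℓs i)) (Pφ c a (ℓs i))) *
             ((if Function.Injective ℓs then (1:ℝ) else 0) *
                ∑ e, wψ e (Finset.image ℓs Finset.univ) *
                  ∏ i, ∑ b, ωψ e b (ℓs i) * gaussN (xs i) (mψ e b (ℓs i)) (Pψ e b (ℓs i)))))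
    = ∑' J : Finset L, ∑ c, ∑ e,
        ENNReal.ofReal (wφ c J) * ENNReal.ofReal (wψ e J) *
          ∏ ℓ ∈ J, ENNReal.ofReal
            (∑ a, ∑ b, ωφ c a ℓ * ωψ e b ℓ *
              gaussN (mφ c a ℓ) (mψ e b ℓ) (Pφ c a ℓ + Pψ e b ℓ)) := by
  rw [← tsum_inv_factorial_mul_tsum_injective]
  refine tsum_congr fun n => congrArg _ (tsum_congr fun ℓs => ?_)
  split_ifs with hinj
  · simp only [one_pow, one_mul]
    rw [lintegral_mixture_prod_mul _ _ (fun c => hwφ c _) (fun e => hwψ e _)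
      (fun c i x => ∑ a, ωφ c a (ℓs i) * gaussN x (mφ c a (ℓs i)) (Pφ c a (ℓs i)))
      (fun e i x => ∑ b, ωψ e b (ℓs i) * gaussN x (mψ e b (ℓs i)) (Pψ e b (ℓs i)))
      (fun c i x => Finset.sum_nonneg fun a _ => mul_nonneg (hωφ0 c a _) (gaussN_nonneg _ _ _))
      (fun e i x => Finset.sum_nonneg fun b _ => mul_nonneg (hωψ0 e b _) (gaussN_nonneg _ _ _))
      (fun c i => Finset.measurable_sum _ fun a _ => (measurable_gaussN _ _).const_mul _)
      (fun e i => Finset.measurable_sum _ fun b _ => (measurable_gaussN _ _).const_mul _)]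
    refine Finset.sum_congr rfl fun c _ => Finset.sum_congr rfl fun e _ => congrArg _ ?_
    rw [Finset.prod_image hinj.injOn]
    exact Finset.prod_congr rfl fun i _ => lintegral_gaussian_mixture_mul _ _ _ _ _ _
      (fun a => hωφ0 c a _) (fun b => hωψ0 e b _) (fun a => hPφ c a _) (fun b => hPψ e b _)
  · simp
end
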